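/- Let α ∈ (0,1], T > 0, let a : [0,T] → ℝ be continuous, and consider f(t,x) = a(t)·x. Let x₁ and x₂ be solutions on [0,T] of the corresponding Caputo fractional initial value problems with initial values x₁(0) ≠ x₂(0). Then for all t ∈ [0,T]: |x₂(t) − x₁(t)| ≥ |x₂(0) − x₁(0)| · E_α(a_*(t) t^α), where a_*(t) := min_{τ ∈ [0,t]} a(τ). -/

import Mathlib

open Set intervalIntegral

/-- The one-parameter Mittag-Leffler function `E_α(x) = ∑_{k=0}^∞ x^k / Γ(αk+1)`. -/
noncomputable def mittagLeffler (α x : ℝ) : ℝ :=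
  ∑' k : ℕ, x ^ k / Real.Gamma (α * (k : ℝ) + 1)

/-- A continuous function `x` on `[0,T]` solves the Caputo fractional initial value
problem `^C D^α_{0+} x(t) = f(t,x(t))`, `x(0) = x₀`, in the equivalent Volterra
integral formulation. -/
def IsCaputoSolution (α T : ℝ) (f : ℝ → ℝ → ℝ) (x₀ : ℝ) (x : ℝ → ℝ) : Prop :=
  ContinuousOn x (Set.Icc 0 T) ∧
    ∀ t ∈ Set.Icc 0 T,
      x t = x₀ + (1 / Real.Gamma α) * ∫ s in (0:ℝ)..t, (t - s) ^ (α - 1) * f s (x s)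

open MeasureTheory Filter Topology

/-- The two-parameter Mittag-Leffler function `E_{α,β}(x) = ∑_{k=0}^∞ x^k / Γ(αk+β)`. -/
noncomputable def mittagLefflerTwo (α β x : ℝ) : ℝ :=
  ∑' k : ℕ, x ^ k / Real.Gamma (α * (k : ℝ) + β)

/-- The function `t ↦ t^(β-1) E_{α,β}(l t^α)`, whose Laplace transform is
`s^(α-β) / (s^α - l)`. -/
noncomputable def mittagLefflerKernel (α β l t : ℝ) : ℝ :=
  t ^ (β - 1) * mittagLefflerTwo α β (l * t ^ α)

section BetaIntegral

variable {p q t : ℝ}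

lemma integral_sub_rpow_mul_rpow (hp : 0 < p) (hq : 0 < q) (ht : 0 < t) :
    ∫ s in (0:ℝ)..t, (t - s) ^ (p - 1) * s ^ (q - 1) =
      Real.Gamma p * Real.Gamma q / Real.Gamma (p + q) * t ^ (p + q - 1) := by
  have h := Complex.betaIntegral_scaled (q : ℂ) (p : ℂ) ht
  rw [Complex.betaIntegral_eq_Gamma_mul_div _ _ (by simpa) (by simpa)] at h
  have h2 : (∫ x in (0:ℝ)..t, (x : ℂ) ^ ((q : ℂ) - 1) * ((t : ℂ) - x) ^ ((p : ℂ) - 1)) =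
      ((∫ s in (0:ℝ)..t, (t - s) ^ (p - 1) * s ^ (q - 1) : ℝ) : ℂ) := by
    rw [← intervalIntegral.integral_ofReal]
    refine intervalIntegral.integral_congr fun s hs => ?_
    rw [uIcc_of_le ht.le] at hs
    push_cast
    rw [Complex.ofReal_cpow (by linarith [hs.2]), Complex.ofReal_cpow hs.1]
    push_cast
    ring
  rw [h2, Complex.Gamma_ofReal, Complex.Gamma_ofReal] at h
  have h3 : (t : ℂ) ^ ((q : ℂ) + p - 1) = ((t ^ (p + q - 1) : ℝ) : ℂ) := by
    rw [Complex.ofReal_cpow ht.le]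
    push_cast
    ring_nf
  rw [h3, ← Complex.ofReal_add, Complex.Gamma_ofReal] at h
  have h4 : ∫ s in (0:ℝ)..t, (t - s) ^ (p - 1) * s ^ (q - 1) =
      t ^ (p + q - 1) * (Real.Gamma q * Real.Gamma p / Real.Gamma (q + p)) := by
    exact_mod_cast h
  rw [h4, add_comm q p]
  ring

lemma intervalIntegrable_sub_rpow_mul_rpow (hp : 0 < p) (hq : 0 < q) (ht : 0 < t) :
    IntervalIntegrable (fun s => (t - s) ^ (p - 1) * s ^ (q - 1)) volume 0 t := by
  apply intervalIntegral.intervalIntegrable_of_integral_ne_zero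
  rw [integral_sub_rpow_mul_rpow hp hq ht]
  have := Real.Gamma_pos_of_pos hp
  have := Real.Gamma_pos_of_pos hq
  have := Real.Gamma_pos_of_pos (add_pos hp hq)
  positivity

end BetaIntegral

section MittagLeffler

variable {α β : ℝ}

lemma Gamma_mul_rpow_le_Gamma_add (hα : 0 < α) {y : ℝ} (hy : 1 < y) :
    Real.Gamma y * (y - 1) ^ α ≤ Real.Gamma (y + α) := by
  have h := Real.convexOn_log_Gamma.slope_mono_adjacent (x := y - 1) (y := y) (z := y + α)
    (by simp only [mem_Ioi]; linarith) (by simp only [mem_Ioi]; linarith) (by linarith)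
    (by linarith)
  have g0 := Real.Gamma_pos_of_pos (show 0 < y - 1 by linarith)
  have g1 := Real.Gamma_pos_of_pos (show 0 < y by linarith)
  have g2 := Real.Gamma_pos_of_pos (show 0 < y + α by linarith)
  have e : Real.Gamma y = (y - 1) * Real.Gamma (y - 1) := by
    have := Real.Gamma_add_one (show y - 1 ≠ 0 by linarith)
    rwa [sub_add_cancel] at this
  have e2 : Real.log (Real.Gamma y) = Real.log (y - 1) + Real.log (Real.Gamma (y - 1)) := by
    rw [e, Real.log_mul (by linarith) g0.ne']
  simp only [Function.comp_apply, sub_sub_cancel, div_one, add_sub_cancel_left] at h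
  rw [le_div_iff₀ hα] at h
  have hpos : 0 < (y - 1) ^ α := Real.rpow_pos_of_pos (by linarith) _
  rw [← Real.log_le_log_iff (by positivity) g2, Real.log_mul g1.ne' hpos.ne',
    Real.log_rpow (by linarith)]
  have : Real.log (Real.Gamma y) - Real.log (Real.Gamma (y - 1)) = Real.log (y - 1) := by
    rw [e2]; ring
  rw [this] at h
  linarith

lemma summable_mittagLefflerTwo (hα : 0 < α) (hβ : 0 < β) (x : ℝ) :
    Summable fun k : ℕ => x ^ k / Real.Gamma (α * (k : ℝ) + β) := by
  refine summable_of_ratio_norm_eventually_le (r := 1 / 2) (by norm_num) ?_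
  have hlin : Tendsto (fun k : ℕ => α * (k : ℝ) + β - 1) atTop atTop :=
    tendsto_atTop_add_const_right _ _ (tendsto_atTop_add_const_right _ _
      (tendsto_natCast_atTop_atTop.const_mul_atTop hα))
  have hpow := (tendsto_rpow_atTop hα).comp hlin
  filter_upwards [hlin.eventually_gt_atTop 0, hpow.eventually_ge_atTop (2 * |x|)] with k hk hk2
  simp only [Function.comp_apply] at hk2
  have hG := Gamma_mul_rpow_le_Gamma_add hα (show 1 < α * (k : ℝ) + β by linarith)
  have g1 := Real.Gamma_pos_of_pos (show 0 < α * (k : ℝ) + β by positivity)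
  have g2 := Real.Gamma_pos_of_pos (show 0 < α * (k : ℝ) + β + α by positivity)
  have e : α * ((k + 1 : ℕ) : ℝ) + β = α * (k : ℝ) + β + α := by push_cast; ring
  rw [e, norm_div, norm_div, norm_pow, norm_pow, Real.norm_of_nonneg g1.le,
    Real.norm_of_nonneg g2.le, Real.norm_eq_abs, pow_succ, ← mul_div_assoc,
    div_le_div_iff₀ g2 g1]
  have h1 : |x| * Real.Gamma (α * (k : ℝ) + β) ≤ 1 / 2 * Real.Gamma (α * (k : ℝ) + β + α) := by
    nlinarith
  nlinarith [pow_nonneg (abs_nonneg x) k]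

lemma continuous_mittagLefflerTwo (hα : 0 < α) (hβ : 0 < β) :
    Continuous (mittagLefflerTwo α β) := by
  rw [continuous_iff_continuousAt]
  intro x
  have h : ContinuousOn (mittagLefflerTwo α β) (Metric.ball 0 (|x| + 1)) := by
    refine continuousOn_tsum (fun k => by fun_prop) (summable_mittagLefflerTwo hα hβ (|x| + 1)) ?_
    intro k y hy
    have g1 := Real.Gamma_pos_of_pos (show 0 < α * (k : ℝ) + β by positivity)
    rw [norm_div, norm_pow, Real.norm_of_nonneg g1.le]
    gcongr
    simpa using (mem_ball_zero_iff.1 hy).le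
  exact h.continuousAt (Metric.isOpen_ball.mem_nhds (by simp))

lemma mittagLefflerTwo_zero : mittagLefflerTwo α β 0 = 1 / Real.Gamma β := by
  rw [mittagLefflerTwo, tsum_eq_single 0]
  · simp
  · intro k hk
    simp [hk]

lemma mittagLefflerTwo_pos_of_nonneg (hα : 0 < α) (hβ : 0 < β) {x : ℝ} (hx : 0 ≤ x) :
    0 < mittagLefflerTwo α β x := by
  refine (summable_mittagLefflerTwo hα hβ x).tsum_pos (fun k => ?_) 0 ?_
  · have g1 := Real.Gamma_pos_of_pos (show 0 < α * (k : ℝ) + β by positivity)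
    positivity
  · have := Real.Gamma_pos_of_pos hβ
    simpa

lemma measurable_mittagLefflerKernel (hα : 0 < α) (hβ : 0 < β) (l : ℝ) :
    Measurable (mittagLefflerKernel α β l) :=
  (measurable_id.pow_const _).mul ((continuous_mittagLefflerTwo hα hβ).measurable.comp
    ((measurable_id.pow_const _).const_mul _))

lemma continuous_mittagLefflerTwo_rpow (hα : 0 < α) (hβ : 0 < β) (l : ℝ) :
    Continuous fun t : ℝ => mittagLefflerTwo α β (l * t ^ α) :=
  (continuous_mittagLefflerTwo hα hβ).comp
    ((Real.continuous_rpow_const hα.le).const_mul _)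

lemma hasSum_mittagLefflerKernel (hα : 0 < α) (hβ : 0 < β) (l : ℝ) {t : ℝ} (ht : 0 < t) :
    HasSum (fun k : ℕ => l ^ k / Real.Gamma (α * (k : ℝ) + β) * t ^ (α * (k : ℝ) + β - 1))
      (mittagLefflerKernel α β l t) := by
  refine ((summable_mittagLefflerTwo hα hβ (l * t ^ α)).hasSum.mul_left (t ^ (β - 1))).congr_fun
    fun k => ?_
  rw [add_sub_assoc, Real.rpow_add ht, Real.rpow_mul ht.le, Real.rpow_natCast, mul_pow]
  ring

/-- The Laplace-transform identity behind `mittagLefflerKernel`, in integral form. -/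
lemma mittagLefflerKernel_eq (hα : 0 < α) (hβ : 0 < β) (l : ℝ) {t : ℝ} (ht : 0 < t) :
    mittagLefflerKernel α β l t = t ^ (β - 1) / Real.Gamma β +
      l / Real.Gamma α * ∫ s in (0:ℝ)..t, (t - s) ^ (α - 1) * mittagLefflerKernel α β l s := by
  set c : ℕ → ℝ := fun k => l ^ k / Real.Gamma (α * (k : ℝ) + β) with hc
  have hq : ∀ k : ℕ, 0 < α * (k : ℝ) + β := fun k => by positivity
  have hg : ∀ k : ℕ, 0 < Real.Gamma (α * (k : ℝ) + β) := fun k => Real.Gamma_pos_of_pos (hq k)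
  have hga := Real.Gamma_pos_of_pos hα
  have hint : ∀ k : ℕ, ∀ m : ℝ,
      ∫ s in Ioc 0 t, m * ((t - s) ^ (α - 1) * s ^ (α * (k : ℝ) + β - 1)) =
      m * (Real.Gamma α * Real.Gamma (α * (k : ℝ) + β) / Real.Gamma (α * ((k + 1 : ℕ) : ℝ) + β) *
        t ^ (α * ((k + 1 : ℕ) : ℝ) + β - 1)) := by
    intro k m
    have e : α * ((k + 1 : ℕ) : ℝ) + β = α + (α * (k : ℝ) + β) := by push_cast; ring
    rw [MeasureTheory.integral_const_mul, ← intervalIntegral.integral_of_le ht.le,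
      integral_sub_rpow_mul_rpow hα (hq k) ht, e]
  have key := hasSum_integral_of_summable_integral_norm (μ := volume.restrict (Ioc 0 t))
    (F := fun (k : ℕ) s => c k * ((t - s) ^ (α - 1) * s ^ (α * (k : ℝ) + β - 1))) ?_ ?_
  · have e : ∫ s in Ioc 0 t, ∑' k : ℕ, c k * ((t - s) ^ (α - 1) * s ^ (α * (k : ℝ) + β - 1)) =
        ∫ s in (0:ℝ)..t, (t - s) ^ (α - 1) * mittagLefflerKernel α β l s := by
      rw [intervalIntegral.integral_of_le ht.le]
      refine setIntegral_congr_fun measurableSet_Ioc fun s hs => ?_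
      rw [← (hasSum_mittagLefflerKernel hα hβ l hs.1).tsum_eq, ← tsum_mul_left]
      refine tsum_congr fun k => ?_
      ring
    rw [e] at key
    have h0 := hasSum_mittagLefflerKernel hα hβ l ht
    have h1 := (hasSum_nat_add_iff' 1).2 h0
    have h2 := key.mul_left (l / Real.Gamma α)
    have h3 := h1.unique (h2.congr_fun ?_)
    · simp at h3
      rw [← h3]
      ring
    · intro k
      have := (hg k).ne'
      rw [hint]
      simp only [hc]
      rw [pow_succ]
      field_simp
  · intro k
    have := intervalIntegrable_sub_rpow_mul_rpow hα (hq k) ht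
    rw [intervalIntegrable_iff_integrableOn_Ioc_of_le ht.le] at this
    exact this.const_mul _
  · refine ((summable_mittagLefflerTwo hα (add_pos hα hβ) (|l| * t ^ α)).mul_left
      (Real.Gamma α * t ^ (α + β - 1))).congr fun k => ?_
    have h1 : ∫ s in Ioc 0 t, ‖c k * ((t - s) ^ (α - 1) * s ^ (α * (k : ℝ) + β - 1))‖ =
        ∫ s in Ioc 0 t, |c k| * ((t - s) ^ (α - 1) * s ^ (α * (k : ℝ) + β - 1)) := by
      refine setIntegral_congr_fun measurableSet_Ioc fun s hs => ?_
      have h0 := Real.rpow_nonneg (sub_nonneg.2 hs.2) (α - 1)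
      have h0' := Real.rpow_nonneg hs.1.le (α * (k : ℝ) + β - 1)
      simp only [norm_mul, Real.norm_eq_abs, abs_of_nonneg h0, abs_of_nonneg h0']
    have e : α * ((k + 1 : ℕ) : ℝ) + β - 1 = (α + β - 1) + α * k := by push_cast; ring
    have e' : α * ((k + 1 : ℕ) : ℝ) + β = α * k + (α + β) := by push_cast; ring
    have := (hg k).ne'
    have hc' : |c k| = |l| ^ k / Real.Gamma (α * (k : ℝ) + β) := by
      simp only [hc, abs_div, abs_pow, abs_of_pos (hg k)]
    rw [h1, hint, e, e', hc', Real.rpow_add ht, Real.rpow_mul ht.le, Real.rpow_natCast, mul_pow]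
    field_simp

end MittagLeffler

section Positivity

variable {α β : ℝ}

lemma pos_of_no_first_zero {φ : ℝ → ℝ} {b : ℝ} (hφ : ContinuousOn φ (Icc 0 b)) (h0 : 0 < φ 0)
    (h : ∀ t ∈ Ioc 0 b, (∀ s ∈ Ico 0 t, 0 < φ s) → φ t ≠ 0) : ∀ t ∈ Icc 0 b, 0 < φ t := by
  have main : ∀ t ∈ Icc 0 b, φ t ≠ 0 := by
    by_contra! hcon
    obtain ⟨t, ht, hφt⟩ := hcon
    set Z := Icc 0 b ∩ φ ⁻¹' {0} with hZ
    have hZc : IsClosed Z := hφ.preimage_isClosed_of_isClosed isClosed_Icc isClosed_singleton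
    have hZb : BddBelow Z := ⟨0, fun x hx => hx.1.1⟩
    have hm : sInf Z ∈ Z := hZc.csInf_mem ⟨t, ht, hφt⟩ hZb
    have hm0 : sInf Z ≠ 0 := fun e => by
      have := hm.2
      rw [e] at this
      exact h0.ne' this
    refine h _ ⟨lt_of_le_of_ne hm.1.1 hm0.symm, hm.1.2⟩ (fun s hs => ?_) hm.2
    by_contra! hneg
    have hsub : Icc 0 s ⊆ Icc 0 b := Icc_subset_Icc_right (hs.2.le.trans hm.1.2)
    obtain ⟨y, hy, hy0⟩ := intermediate_value_Icc' hs.1 (hφ.mono hsub) ⟨hneg, h0.le⟩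
    exact absurd (csInf_le hZb ⟨hsub hy, hy0⟩) (not_le.2 (hy.2.trans_lt hs.2))
  intro t ht
  by_contra! hneg
  have hsub : Icc 0 t ⊆ Icc 0 b := Icc_subset_Icc_right ht.2
  obtain ⟨y, hy, hy0⟩ := intermediate_value_Icc' ht.1 (hφ.mono hsub) ⟨hneg, h0.le⟩
  exact main y (hsub hy) hy0

lemma intervalIntegrable_sub_rpow_mul_mittagLefflerKernel (hα : 0 < α) (hβ : 0 < β) (l : ℝ)
    {t : ℝ} (ht : 0 < t) :
    IntervalIntegrable (fun s => (t - s) ^ (α - 1) * mittagLefflerKernel α β l s) volume 0 t := by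
  refine ((intervalIntegrable_sub_rpow_mul_rpow hα hβ ht).mul_continuousOn
    (continuous_mittagLefflerTwo_rpow hα hβ l).continuousOn).congr fun s _ => ?_
  simp only [mittagLefflerKernel]
  ring

lemma integral_sub_rpow (hα : 0 < α) (s t : ℝ) :
    ∫ r in s..t, (t - r) ^ (α - 1) = (t - s) ^ α / α := by
  rw [intervalIntegral.integral_comp_sub_left (fun x => x ^ (α - 1)),
    integral_rpow (Or.inl (by linarith))]
  simp [Real.zero_rpow hα.ne']

lemma intervalIntegrable_sub_rpow (hα : 0 < α) (s t : ℝ) :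
    IntervalIntegrable (fun r => (t - r) ^ (α - 1)) volume s t := by
  have := (intervalIntegral.intervalIntegrable_rpow' (a := t - s) (b := 0)
    (show -1 < α - 1 by linarith)).comp_sub_left t
  simpa using this

lemma sub_rpow_le_div_rpow_mul_sub_rpow (hα1 : α ≤ 1) (hαβ : α ≤ β) {r s t : ℝ}
    (hr : 0 ≤ r) (hrs : r < s) (hst : s ≤ t) :
    (t - r) ^ (α - 1) ≤ (t / s) ^ (β - 1) * (s - r) ^ (α - 1) := by
  have hs : 0 < s := hr.trans_lt hrs
  have hsr : 0 < s - r := sub_pos.2 hrs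
  have htr : 0 < t - r := by linarith
  have h1 : 1 ≤ t / s := (one_le_div hs).2 hst
  have h2 : t / s ≤ (t - r) / (s - r) := by
    rw [div_le_div_iff₀ hs hsr]
    nlinarith
  have h3 : ((t - r) / (s - r)) ^ (α - 1) ≤ (t / s) ^ (β - 1) :=
    (Real.rpow_le_rpow_of_nonpos (by linarith) h2 (by linarith)).trans
      (Real.rpow_le_rpow_of_exponent_le h1 (by linarith))
  rwa [Real.div_rpow htr.le hsr.le, div_le_iff₀ (Real.rpow_pos_of_pos hsr _)] at h3

lemma mittagLefflerKernel_pos_iff (l : ℝ) {t : ℝ} (ht : 0 < t) :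
    0 < mittagLefflerKernel α β l t ↔ 0 < mittagLefflerTwo α β (l * t ^ α) :=
  mul_pos_iff_of_pos_left (Real.rpow_pos_of_pos ht _)

lemma mittagLefflerTwo_ne_zero_of_pos_before (hα : 0 < α) (hα1 : α ≤ 1) (hαβ : α ≤ β)
    (hβ1 : β ≤ 1) {l : ℝ} (hl : l ≤ 0) {t : ℝ} (ht : 0 < t)
    (hpos : ∀ s ∈ Ico 0 t, 0 < mittagLefflerTwo α β (l * s ^ α)) :
    mittagLefflerTwo α β (l * t ^ α) ≠ 0 := by
  intro hzero
  have hβ : 0 < β := hα.trans_le hαβ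
  have hΓ := Real.Gamma_pos_of_pos hα
  set F := mittagLefflerKernel α β l with hF
  have hFt : F t = 0 := by simp [hF, mittagLefflerKernel, hzero]
  have hFpos : ∀ s ∈ Ioo 0 t, 0 < F s := fun s hs =>
    (mittagLefflerKernel_pos_iff l hs.1).2 (hpos s ⟨hs.1.le, hs.2⟩)
  obtain ⟨δ, hδ, hδt, hδs⟩ : ∃ δ > 0, δ < t / 2 ∧ -l / Real.Gamma α * (δ ^ α / α) < 1 / 2 := by
    have hc : Tendsto (fun δ : ℝ => -l / Real.Gamma α * (δ ^ α / α)) (𝓝[>] 0) (𝓝 0) := by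
      have : Continuous fun δ : ℝ => -l / Real.Gamma α * (δ ^ α / α) :=
        continuous_const.mul ((Real.continuous_rpow_const hα.le).div_const _)
      have h := this.tendsto 0
      simp only [Real.zero_rpow hα.ne', zero_div, mul_zero] at h
      exact h.mono_left nhdsWithin_le_nhds
    obtain ⟨δ, h1, h2, h3⟩ := ((hc.eventually_lt_const (show (0:ℝ) < 1 / 2 by norm_num)).and
      ((eventually_mem_nhdsWithin (a := (0:ℝ)) (s := Ioi 0)).and
        (eventually_nhdsWithin_of_eventually_nhds
          (eventually_lt_nhds (show (0:ℝ) < t / 2 by linarith))))).exists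
    exact ⟨δ, h2, h3, h1⟩
  have hFc : ContinuousOn F (Icc (t - δ) t) := by
    refine ContinuousOn.mul (continuousOn_id.rpow_const fun x hx => Or.inl ?_)
      (continuous_mittagLefflerTwo_rpow hα hβ l).continuousOn
    have := hx.1
    simp only [id]
    linarith
  obtain ⟨s, hs, hmax⟩ := isCompact_Icc.exists_isMaxOn ⟨t, by simp [hδ.le]⟩ hFc
  have hFs : 0 < F s := (hFpos (t - δ) ⟨by linarith, by linarith⟩).trans_le
    (hmax ⟨le_rfl, by linarith⟩)
  have hst : s < t := lt_of_le_of_ne hs.2 fun e => by rw [e, hFt] at hFs; exact lt_irrefl _ hFs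
  have hs2 : t / 2 < s := by linarith [hs.1]
  have hs0 : 0 < s := by linarith
  set c := (t / s) ^ (β - 1) with hc
  have hc2 : 1 / 2 ≤ c := by
    have h1 : (2:ℝ) ^ (β - 1) ≤ c :=
      Real.rpow_le_rpow_of_nonpos (by positivity) ((div_le_iff₀ hs0).2 (by linarith))
        (by linarith)
    have h2 : (2:ℝ) ^ (-1:ℝ) ≤ 2 ^ (β - 1) :=
      Real.rpow_le_rpow_of_exponent_le (by norm_num) (by linarith)
    rw [Real.rpow_neg_one] at h2
    linarith
  have hcs : c * (s ^ (β - 1) / Real.Gamma β) = t ^ (β - 1) / Real.Gamma β := by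
    rw [hc, Real.div_rpow ht.le hs0.le]
    have := (Real.rpow_pos_of_pos hs0 (β - 1)).ne'
    field_simp
  have eqt := mittagLefflerKernel_eq hα hβ l ht
  have eqs := mittagLefflerKernel_eq hα hβ l hs0
  have hit := intervalIntegrable_sub_rpow_mul_mittagLefflerKernel hα hβ l ht
  have his := intervalIntegrable_sub_rpow_mul_mittagLefflerKernel hα hβ l hs0
  rw [← hF] at eqt eqs hit his
  have hit1 : IntervalIntegrable (fun r => (t - r) ^ (α - 1) * F r) volume 0 s :=
    hit.mono_set (by rw [uIcc_of_le hs0.le, uIcc_of_le ht.le]; exact Icc_subset_Icc_right hst.le)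
  have hit2 : IntervalIntegrable (fun r => (t - r) ^ (α - 1) * F r) volume s t :=
    hit.mono_set (by rw [uIcc_of_le hst.le, uIcc_of_le ht.le]; exact Icc_subset_Icc_left hs0.le)
  rw [← intervalIntegral.integral_add_adjacent_intervals hit1 hit2, hFt] at eqt
  have h1 : ∫ r in (0:ℝ)..s, (t - r) ^ (α - 1) * F r ≤
      c * ∫ r in (0:ℝ)..s, (s - r) ^ (α - 1) * F r := by
    rw [← intervalIntegral.integral_const_mul]
    refine intervalIntegral.integral_mono_on_of_le_Ioo hs0.le hit1 (his.const_mul c) fun r hr => ?_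
    have := sub_rpow_le_div_rpow_mul_sub_rpow hα1 hαβ hr.1.le hr.2 hst.le
    have hFr := (hFpos r ⟨hr.1, hr.2.trans hst⟩).le
    calc _ ≤ (c * (s - r) ^ (α - 1)) * F r := by gcongr
      _ = _ := by ring
  have h2 : ∫ r in s..t, (t - r) ^ (α - 1) * F r ≤ δ ^ α / α * F s := by
    calc _ ≤ ∫ r in s..t, (t - r) ^ (α - 1) * F s := by
          refine intervalIntegral.integral_mono_on hst.le hit2
            ((intervalIntegrable_sub_rpow hα s t).mul_const _) fun r hr => ?_
          have h0 := Real.rpow_nonneg (sub_nonneg.2 hr.2) (α - 1)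
          exact mul_le_mul_of_nonneg_left (hmax ⟨hs.1.trans hr.1, hr.2⟩) h0
      _ = (t - s) ^ α / α * F s := by
          rw [intervalIntegral.integral_mul_const, integral_sub_rpow hα]
      _ ≤ _ := by
          have : (t - s) ^ α ≤ δ ^ α :=
            Real.rpow_le_rpow (by linarith) (by linarith [hs.1]) hα.le
          gcongr
  have hl' : 0 ≤ -l / Real.Gamma α := div_nonneg (by linarith) hΓ.le
  have e1 : l / Real.Gamma α = -(-l / Real.Gamma α) := by ring
  rw [e1] at eqt eqs
  set m := -l / Real.Gamma α
  have k1 := mul_le_mul_of_nonneg_left h1 hl'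
  have k2 := mul_le_mul_of_nonneg_left h2 hl'
  have k3 := mul_lt_mul_of_pos_right hδs hFs
  have k4 := mul_le_mul_of_nonneg_right hc2 hFs.le
  have k5 : c * F s = t ^ (β - 1) / Real.Gamma β -
      m * (c * ∫ r in (0:ℝ)..s, (s - r) ^ (α - 1) * F r) := by
    rw [eqs, mul_add, hcs]
    ring
  nlinarith

lemma mittagLefflerTwo_pos (hα : 0 < α) (hα1 : α ≤ 1) (hαβ : α ≤ β) (hβ1 : β ≤ 1) (l : ℝ)
    {t : ℝ} (ht : 0 ≤ t) : 0 < mittagLefflerTwo α β (l * t ^ α) := by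
  have hβ : 0 < β := hα.trans_le hαβ
  rcases le_total 0 l with hl | hl
  · exact mittagLefflerTwo_pos_of_nonneg hα hβ (by positivity)
  · refine pos_of_no_first_zero (φ := fun t => mittagLefflerTwo α β (l * t ^ α)) (b := t)
      (continuous_mittagLefflerTwo_rpow hα hβ l).continuousOn ?_ ?_ t ⟨ht, le_rfl⟩
    · simp only [Real.zero_rpow hα.ne', mul_zero, mittagLefflerTwo_zero]
      have := Real.Gamma_pos_of_pos hβ
      positivity
    · exact fun s hs h => mittagLefflerTwo_ne_zero_of_pos_before hα hα1 hαβ hβ1 hl hs.1 h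

lemma mittagLefflerKernel_nonneg (hα : 0 < α) (hα1 : α ≤ 1) (hαβ : α ≤ β) (hβ1 : β ≤ 1) (l : ℝ)
    {t : ℝ} (ht : 0 ≤ t) : 0 ≤ mittagLefflerKernel α β l t :=
  mul_nonneg (Real.rpow_nonneg ht _) (mittagLefflerTwo_pos hα hα1 hαβ hβ1 l ht).le

end Positivity

section Resolvent

/-- Dirichlet's formula for interchanging the order of integration over a triangle. -/
lemma integral_integral_triangle_swap {f : ℝ → ℝ → ℝ} {r : ℝ} (hr : 0 ≤ r)
    (hf : Integrable ({p : ℝ × ℝ | p.2 < p.1}.indicator (Function.uncurry f))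
      ((volume.restrict (Ioo 0 r)).prod (volume.restrict (Ioo 0 r)))) :
    ∫ s in (0:ℝ)..r, ∫ q in (0:ℝ)..s, f s q = ∫ q in (0:ℝ)..r, ∫ s in q..r, f s q := by
  have hswap := integral_integral_swap
    (f := fun s q => {p : ℝ × ℝ | p.2 < p.1}.indicator (Function.uncurry f) (s, q)) hf
  rw [intervalIntegral.integral_of_le hr, intervalIntegral.integral_of_le hr,
    integral_Ioc_eq_integral_Ioo, integral_Ioc_eq_integral_Ioo]
  convert hswap using 1
  · refine setIntegral_congr_fun measurableSet_Ioo fun s hs => ?_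
    have e : (fun q => {p : ℝ × ℝ | p.2 < p.1}.indicator (Function.uncurry f) (s, q)) =
        (Iio s).indicator fun q => f s q := rfl
    have e2 : Ioo 0 r ∩ Iio s = Ioo 0 s := by
      rw [Ioo_inter_Iio, min_eq_right hs.2.le]
    simp only [e]
    rw [setIntegral_indicator measurableSet_Iio, e2, intervalIntegral.integral_of_le hs.1.le,
      integral_Ioc_eq_integral_Ioo]
  · refine setIntegral_congr_fun measurableSet_Ioo fun q hq => ?_
    have e : (fun s => {p : ℝ × ℝ | p.2 < p.1}.indicator (Function.uncurry f) (s, q)) =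
        (Ioi q).indicator fun s => f s q := rfl
    have e2 : Ioo 0 r ∩ Ioi q = Ioo q r := by
      rw [Ioo_inter_Ioi, max_eq_right hq.1.le]
    simp only [e]
    rw [setIntegral_indicator measurableSet_Ioi, e2, intervalIntegral.integral_of_le hq.2.le,
      integral_Ioc_eq_integral_Ioo]

variable {α : ℝ}

lemma integral_sub_mul_sub {k R : ℝ → ℝ} (q r : ℝ) :
    ∫ s in q..r, R (r - s) * k (s - q) = ∫ p in (0:ℝ)..(r - q), k (r - q - p) * R p := by
  have := intervalIntegral.integral_comp_sub_left (a := q) (b := r)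
    (fun p => k (r - q - p) * R p) r
  rw [sub_self] at this
  rw [← this]
  refine intervalIntegral.integral_congr fun s _ => ?_
  rw [show r - q - (r - s) = s - q by ring, mul_comm]

lemma intervalIntegrable_sub_mul_sub {k R : ℝ → ℝ} {q r : ℝ}
    (h : IntervalIntegrable (fun p => k (r - q - p) * R p) volume 0 (r - q)) :
    IntervalIntegrable (fun s => R (r - s) * k (s - q)) volume q r := by
  have := (h.comp_sub_left r).symm
  simp only [sub_sub_cancel, sub_zero] at this
  refine this.congr fun s _ => ?_
  rw [show r - q - (r - s) = s - q by ring, mul_comm]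

lemma integrable_triangle_sub_rpow_mul_sub_rpow (hα : 0 < α) {r : ℝ} (hr : 0 < r) :
    Integrable ({p : ℝ × ℝ | p.2 < p.1}.indicator
      (fun p => (r - p.1) ^ (α - 1) * (p.1 - p.2) ^ (α - 1)))
      ((volume.restrict (Ioo 0 r)).prod (volume.restrict (Ioo 0 r))) := by
  have hmeas : Measurable ({p : ℝ × ℝ | p.2 < p.1}.indicator
      (fun p => (r - p.1) ^ (α - 1) * (p.1 - p.2) ^ (α - 1))) :=
    Measurable.indicator (by fun_prop) (measurableSet_lt measurable_snd measurable_fst)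
  rw [integrable_prod_iff' hmeas.aestronglyMeasurable]
  have e (q : ℝ) : (fun s => {p : ℝ × ℝ | p.2 < p.1}.indicator
      (fun p => (r - p.1) ^ (α - 1) * (p.1 - p.2) ^ (α - 1)) (s, q)) =
        (Ioi q).indicator fun s => (r - s) ^ (α - 1) * (s - q) ^ (α - 1) := rfl
  have e2 {q : ℝ} (hq : q ∈ Ioo 0 r) : Ioo 0 r ∩ Ioi q = Ioo q r := by
    rw [Ioo_inter_Ioi, max_eq_right hq.1.le]
  constructor
  · filter_upwards [ae_restrict_mem measurableSet_Ioo] with q hq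
    rw [e, integrable_indicator_iff measurableSet_Ioi, IntegrableOn,
      Measure.restrict_restrict measurableSet_Ioi, inter_comm, e2 hq]
    have := intervalIntegrable_sub_mul_sub (k := fun x => x ^ (α - 1))
      (R := fun x => x ^ (α - 1)) (intervalIntegrable_sub_rpow_mul_rpow hα hα (sub_pos.2 hq.2))
    exact (intervalIntegrable_iff_integrableOn_Ioo_of_le hq.2.le).1 this
  · have hint : IntegrableOn (fun q => Real.Gamma α * Real.Gamma α / Real.Gamma (α + α) *
        (r - q) ^ (α + α - 1)) (Ioo 0 r) :=
      (intervalIntegrable_iff_integrableOn_Ioo_of_le hr.le).1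
        ((intervalIntegrable_sub_rpow (add_pos hα hα) 0 r).const_mul _)
    refine hint.congr_fun (fun q hq => ?_) measurableSet_Ioo
    have hn : (fun s => ‖{p : ℝ × ℝ | p.2 < p.1}.indicator
        (fun p => (r - p.1) ^ (α - 1) * (p.1 - p.2) ^ (α - 1)) (s, q)‖) =
        (Ioi q).indicator fun s => ‖(r - s) ^ (α - 1) * (s - q) ^ (α - 1)‖ := by
      ext s
      exact norm_indicator_eq_indicator_norm _ _
    simp only [hn]
    rw [setIntegral_indicator measurableSet_Ioi, e2 hq,
      ← integral_sub_rpow_mul_rpow hα hα (sub_pos.2 hq.2),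
      ← integral_sub_mul_sub (k := fun x => x ^ (α - 1)) (R := fun x => x ^ (α - 1)),
      intervalIntegral.integral_of_le hq.2.le, integral_Ioc_eq_integral_Ioo]
    refine setIntegral_congr_fun measurableSet_Ioo fun s hs => ?_
    have h1 := Real.rpow_nonneg (sub_nonneg.2 hs.2.le) (α - 1)
    have h2 := Real.rpow_nonneg (sub_nonneg.2 hs.1.le) (α - 1)
    simp only [norm_mul, Real.norm_of_nonneg h1, Real.norm_of_nonneg h2]

lemma integrable_triangle_mittagLefflerKernel (hα : 0 < α) (l : ℝ) {r : ℝ} (hr : 0 < r)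
    {h : ℝ → ℝ} (hh : ContinuousOn h (Icc 0 r)) :
    Integrable ({p : ℝ × ℝ | p.2 < p.1}.indicator (Function.uncurry fun s q =>
      mittagLefflerKernel α α l (r - s) * ((s - q) ^ (α - 1) * h q)))
      ((volume.restrict (Ioo 0 r)).prod (volume.restrict (Ioo 0 r))) := by
  obtain ⟨C, hC⟩ := isCompact_Icc.exists_bound_of_continuousOn hh
  obtain ⟨D, hD⟩ := isCompact_Icc.exists_bound_of_continuousOn
    (continuous_mittagLefflerTwo_rpow hα hα l).continuousOn (s := Icc 0 r)
  have hhm : AEStronglyMeasurable h (volume.restrict (Ioo 0 r)) :=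
    (hh.mono Ioo_subset_Icc_self).aestronglyMeasurable measurableSet_Ioo
  have hK := measurable_mittagLefflerKernel hα hα l
  refine ((integrable_triangle_sub_rpow_mul_sub_rpow hα hr).const_mul (D * C)).mono' ?_ ?_
  · refine AEStronglyMeasurable.indicator ?_ (measurableSet_lt measurable_snd measurable_fst)
    refine AEStronglyMeasurable.mul (Measurable.aestronglyMeasurable (by fun_prop))
      (AEStronglyMeasurable.mul (Measurable.aestronglyMeasurable (by fun_prop)) hhm.comp_snd)
  · rw [Measure.prod_restrict]
    filter_upwards [ae_restrict_mem (measurableSet_Ioo.prod measurableSet_Ioo)] with p hp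
    by_cases hlt : p.2 < p.1
    · rw [indicator_of_mem (show p ∈ {p : ℝ × ℝ | p.2 < p.1} from hlt),
        indicator_of_mem (show p ∈ {p : ℝ × ℝ | p.2 < p.1} from hlt)]
      have h1 := Real.rpow_nonneg (sub_nonneg.2 hp.1.2.le) (α - 1)
      have h2 := Real.rpow_nonneg (sub_nonneg.2 hlt.le) (α - 1)
      have h3 := hC p.2 ⟨hp.2.1.le, hp.2.2.le⟩
      have h4 := hD (r - p.1) ⟨by linarith [hp.1.2], by linarith [hp.1.1]⟩
      have hD0 : 0 ≤ D := (norm_nonneg _).trans h4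
      simp only [Function.uncurry, mittagLefflerKernel, norm_mul, Real.norm_of_nonneg h1,
        Real.norm_of_nonneg h2]
      calc _ ≤ (r - p.1) ^ (α - 1) * D * ((p.1 - p.2) ^ (α - 1) * C) := by gcongr
        _ = _ := by ring
    · rw [indicator_of_notMem (show p ∉ {p : ℝ × ℝ | p.2 < p.1} from hlt),
        indicator_of_notMem (show p ∉ {p : ℝ × ℝ | p.2 < p.1} from hlt)]
      simp

lemma intervalIntegrable_sub_rpow_mul (hα : 0 < α) {h : ℝ → ℝ} {t : ℝ} (ht : 0 ≤ t)
    (hh : ContinuousOn h (Icc 0 t)) :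
    IntervalIntegrable (fun s => (t - s) ^ (α - 1) * h s) volume 0 t :=
  (intervalIntegrable_sub_rpow hα 0 t).mul_continuousOn (by rwa [uIcc_of_le ht])

lemma intervalIntegrable_mittagLefflerKernel_sub_mul (hα : 0 < α) (l : ℝ) {h : ℝ → ℝ} {t : ℝ}
    (ht : 0 ≤ t) (hh : ContinuousOn h (Icc 0 t)) :
    IntervalIntegrable (fun s => mittagLefflerKernel α α l (t - s) * h s) volume 0 t := by
  have h1 : Continuous fun s => mittagLefflerTwo α α (l * (t - s) ^ α) :=
    (continuous_mittagLefflerTwo_rpow hα hα l).comp (continuous_const.sub continuous_id)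
  refine (intervalIntegrable_sub_rpow_mul hα ht (h1.continuousOn.mul hh)).congr fun s _ => ?_
  simp only [mittagLefflerKernel, Pi.mul_apply]
  ring

/-- `mittagLefflerKernel α α l` is the resolvent kernel of the linear Volterra equation
`w = I^α (l w + g)`. -/
lemma eq_integral_mittagLefflerKernel (hα : 0 < α) {l r : ℝ} (hr : 0 ≤ r) {w g : ℝ → ℝ}
    (hwc : ContinuousOn w (Icc 0 r)) (hgc : ContinuousOn g (Icc 0 r))
    (hw : ∀ t ∈ Icc 0 r, w t =
      1 / Real.Gamma α * ∫ s in (0:ℝ)..t, (t - s) ^ (α - 1) * (l * w s + g s)) :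
    w r = ∫ s in (0:ℝ)..r, mittagLefflerKernel α α l (r - s) * g s := by
  rcases hr.eq_or_lt with rfl | hr'
  · simpa using hw 0 (by simp)
  set R := mittagLefflerKernel α α l with hR
  set h : ℝ → ℝ := fun s => l * w s + g s with hh
  have hhc : ContinuousOn h (Icc 0 r) := (hwc.const_smul l).add hgc
  have hΓ := (Real.Gamma_pos_of_pos hα).ne'
  have hRw : l * ∫ s in (0:ℝ)..r, R (r - s) * w s =
      ∫ q in (0:ℝ)..r, (R (r - q) * h q - (r - q) ^ (α - 1) / Real.Gamma α * h q) := by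
    calc l * ∫ s in (0:ℝ)..r, R (r - s) * w s
        = l / Real.Gamma α * ∫ s in (0:ℝ)..r, ∫ q in (0:ℝ)..s,
            R (r - s) * ((s - q) ^ (α - 1) * h q) := by
          rw [div_mul_eq_mul_div, ← mul_div_assoc', ← intervalIntegral.integral_div]
          congr 1
          refine intervalIntegral.integral_congr fun s hs => ?_
          rw [uIcc_of_le hr] at hs
          rw [hw s hs, intervalIntegral.integral_const_mul]
          ring
      _ = l / Real.Gamma α * ∫ q in (0:ℝ)..r, ∫ s in q..r,
            R (r - s) * ((s - q) ^ (α - 1) * h q) := by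
          rw [integral_integral_triangle_swap hr
            (integrable_triangle_mittagLefflerKernel hα l hr' hhc)]
      _ = _ := by
          rw [← intervalIntegral.integral_const_mul, intervalIntegral.integral_of_le hr,
            intervalIntegral.integral_of_le hr, integral_Ioc_eq_integral_Ioo,
            integral_Ioc_eq_integral_Ioo]
          refine setIntegral_congr_fun measurableSet_Ioo fun q hq => ?_
          have e := mittagLefflerKernel_eq hα hα l (sub_pos.2 hq.2)
          rw [← integral_sub_mul_sub (k := fun x => x ^ (α - 1)), ← hR] at e
          simp only [← mul_assoc]
          rw [intervalIntegral.integral_mul_const, e]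
          ring
  have i1 := intervalIntegrable_mittagLefflerKernel_sub_mul hα l hr hwc
  have i2 := intervalIntegrable_mittagLefflerKernel_sub_mul hα l hr hgc
  have i3 := intervalIntegrable_mittagLefflerKernel_sub_mul hα l hr hhc
  have i4 := (intervalIntegrable_sub_rpow_mul hα hr hhc).const_mul (1 / Real.Gamma α)
  have e3 : ∫ s in (0:ℝ)..r, R (r - s) * h s =
      l * (∫ s in (0:ℝ)..r, R (r - s) * w s) + ∫ s in (0:ℝ)..r, R (r - s) * g s := by
    rw [← intervalIntegral.integral_const_mul, ← intervalIntegral.integral_add (i1.const_mul l) i2]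
    refine intervalIntegral.integral_congr fun s _ => ?_
    simp only [hh]
    ring
  have e4 : (∫ q in (0:ℝ)..r, (R (r - q) * h q - (r - q) ^ (α - 1) / Real.Gamma α * h q)) =
      (∫ q in (0:ℝ)..r, R (r - q) * h q) - w r := by
    rw [hw r ⟨hr, le_rfl⟩, ← intervalIntegral.integral_const_mul,
      ← intervalIntegral.integral_sub i3 i4]
    refine intervalIntegral.integral_congr fun s _ => ?_
    ring
  linarith

end Resolvent

section Comparison

variable {α : ℝ}

lemma mittagLefflerTwo_one_eq (hα : 0 < α) (l : ℝ) {t : ℝ} (ht : 0 ≤ t) :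
    mittagLefflerTwo α 1 (l * t ^ α) = 1 + l / Real.Gamma α *
      ∫ s in (0:ℝ)..t, (t - s) ^ (α - 1) * mittagLefflerTwo α 1 (l * s ^ α) := by
  rcases ht.eq_or_lt with rfl | ht
  · simp [Real.zero_rpow hα.ne', mittagLefflerTwo_zero]
  · simpa [mittagLefflerKernel] using mittagLefflerKernel_eq hα one_pos l ht

/-- A solution of `u = 1 + I^α (a u)` dominates the solution of the equation in which `a` is
replaced by a constant lower bound. -/
lemma mittagLeffler_le_of_volterra (hα : 0 < α) (hα1 : α ≤ 1) {l b : ℝ} {a u : ℝ → ℝ}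
    (hb : 0 ≤ b) (ha : ContinuousOn a (Icc 0 b)) (hl : ∀ s ∈ Icc 0 b, l ≤ a s)
    (huc : ContinuousOn u (Icc 0 b))
    (hu : ∀ t ∈ Icc 0 b, u t =
      1 + 1 / Real.Gamma α * ∫ s in (0:ℝ)..t, (t - s) ^ (α - 1) * (a s * u s)) :
    mittagLeffler α (l * b ^ α) ≤ u b := by
  set v : ℝ → ℝ := fun t => mittagLefflerTwo α 1 (l * t ^ α) with hv
  have hvc : Continuous v := continuous_mittagLefflerTwo_rpow hα one_pos l
  have hvpos : ∀ t, 0 ≤ t → 0 < v t := fun t ht => mittagLefflerTwo_pos hα hα1 hα1 le_rfl l ht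
  have hgc : ContinuousOn (fun s => (a s - l) * u s) (Icc 0 b) :=
    (ha.sub continuousOn_const).mul huc
  have rep : ∀ r ∈ Icc 0 b, u r - v r =
      ∫ s in (0:ℝ)..r, mittagLefflerKernel α α l (r - s) * ((a s - l) * u s) := by
    intro r hr
    have hsub : Icc 0 r ⊆ Icc 0 b := Icc_subset_Icc_right hr.2
    refine eq_integral_mittagLefflerKernel hα hr.1 (w := fun t => u t - v t)
      (g := fun s => (a s - l) * u s) ((huc.mono hsub).sub hvc.continuousOn) (hgc.mono hsub) ?_
    intro t ht
    have hsub' : Icc 0 t ⊆ Icc 0 b := (Icc_subset_Icc_right ht.2).trans hsub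
    have i1 := intervalIntegrable_sub_rpow_mul (h := fun s => a s * u s) hα ht.1
      ((ha.mul huc).mono hsub')
    have i2 := (intervalIntegrable_sub_rpow_mul hα ht.1 hvc.continuousOn).const_mul l
    have e : ∫ s in (0:ℝ)..t, (t - s) ^ (α - 1) * (l * (u s - v s) + (a s - l) * u s) =
        (∫ s in (0:ℝ)..t, (t - s) ^ (α - 1) * (a s * u s)) -
          l * ∫ s in (0:ℝ)..t, (t - s) ^ (α - 1) * v s := by
      rw [← intervalIntegral.integral_const_mul, ← intervalIntegral.integral_sub i1 i2]
      refine intervalIntegral.integral_congr fun s _ => ?_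
      ring
    rw [e, hu t (hsub ht), hv]
    simp only
    rw [mittagLefflerTwo_one_eq hα l ht.1]
    ring
  have le_of_nonneg : ∀ r ∈ Icc 0 b, (∀ s ∈ Ico 0 r, 0 < u s) → v r ≤ u r := by
    intro r hr hpos
    rw [← sub_nonneg, rep r hr, intervalIntegral.integral_of_le hr.1,
      integral_Ioc_eq_integral_Ioo]
    refine setIntegral_nonneg measurableSet_Ioo fun s hs => ?_
    refine mul_nonneg (mittagLefflerKernel_nonneg hα hα1 le_rfl hα1 l (sub_nonneg.2 hs.2.le))
      (mul_nonneg (sub_nonneg.2 (hl s ⟨hs.1.le, hs.2.le.trans hr.2⟩))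
        (hpos s ⟨hs.1.le, hs.2⟩).le)
  have hu0 : u 0 = 1 := by simpa using hu 0 ⟨le_rfl, hb⟩
  have hupos := pos_of_no_first_zero huc (by rw [hu0]; exact one_pos) fun t ht hpos =>
    ((hvpos t ht.1.le).trans_le (le_of_nonneg t ⟨ht.1.le, ht.2⟩ hpos)).ne'
  exact le_of_nonneg b ⟨hb, le_rfl⟩ fun s hs => hupos s ⟨hs.1, hs.2.le⟩

end Comparison

/-- Convergence rate for solutions of one-dimensional linear FDEs:
`|x₂(t) − x₁(t)| ≥ |x₂(0) − x₁(0)| · E_α(a_*(t)·t^α)` with `a_*(t) = min_{τ∈[0,t]} a(τ)`. -/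
theorem caputo_linear_lower_bound (α T : ℝ) (hα : 0 < α) (hα1 : α ≤ 1) (hT : 0 < T)
    (a : ℝ → ℝ) (ha : ContinuousOn a (Set.Icc 0 T))
    (x₁₀ x₂₀ : ℝ) (hne : x₁₀ ≠ x₂₀) (x₁ x₂ : ℝ → ℝ)
    (hx₁ : IsCaputoSolution α T (fun t x => a t * x) x₁₀ x₁)
    (hx₂ : IsCaputoSolution α T (fun t x => a t * x) x₂₀ x₂) :
    ∀ t ∈ Set.Icc 0 T,
      |x₂₀ - x₁₀| * mittagLeffler α (sInf (a '' Set.Icc 0 t) * t ^ α)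
        ≤ |x₂ t - x₁ t| := by
  intro t ht
  have hd : x₂₀ - x₁₀ ≠ 0 := sub_ne_zero.2 hne.symm
  have hsub : Icc 0 t ⊆ Icc 0 T := Icc_subset_Icc_right ht.2
  have hbdd : BddBelow (a '' Icc 0 t) :=
    (isCompact_Icc.image_of_continuousOn (ha.mono hsub)).bddBelow
  have key := mittagLeffler_le_of_volterra (l := sInf (a '' Icc 0 t))
    (u := fun s => (x₂ s - x₁ s) / (x₂₀ - x₁₀)) hα hα1 ht.1 (ha.mono hsub)
    (fun s hs => csInf_le hbdd (mem_image_of_mem a hs))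
    (((hx₂.1.sub hx₁.1).mono hsub).div_const _) ?_
  · calc _ ≤ |x₂₀ - x₁₀| * |(x₂ t - x₁ t) / (x₂₀ - x₁₀)| := by
          gcongr
          exact key.trans (le_abs_self _)
      _ = _ := by rw [← abs_mul, mul_div_cancel₀ _ hd]
  · intro r hr
    have hsub' : Icc 0 r ⊆ Icc 0 T := Icc_subset_Icc_right (hsub hr).2
    have i1 := intervalIntegrable_sub_rpow_mul (h := fun s => a s * x₁ s) hα hr.1
      ((ha.mul hx₁.1).mono hsub')
    have i2 := intervalIntegrable_sub_rpow_mul (h := fun s => a s * x₂ s) hα hr.1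
      ((ha.mul hx₂.1).mono hsub')
    have e : ∫ s in (0:ℝ)..r, (r - s) ^ (α - 1) * (a s * ((x₂ s - x₁ s) / (x₂₀ - x₁₀))) =
        ((∫ s in (0:ℝ)..r, (r - s) ^ (α - 1) * (a s * x₂ s)) -
          ∫ s in (0:ℝ)..r, (r - s) ^ (α - 1) * (a s * x₁ s)) / (x₂₀ - x₁₀) := by
      rw [← intervalIntegral.integral_sub i2 i1, ← intervalIntegral.integral_div]
      refine intervalIntegral.integral_congr fun s _ => ?_
      ring
    rw [e, hx₁.2 r (hsub hr), hx₂.2 r (hsub hr)]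
    field_simp
    ring
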